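/- Suppose the step-sizes of the quantized gradient iterates satisfy γ(t) ≥ 0, γ(t) → 0 as t → ∞, and ∑_{t=0}^∞ γ(t) = ∞. Then dist(x(t), X*) → 0 as t → ∞. -/

import Mathlib

open Real Filter RealInnerProductSpace

noncomputable section

section GradientDescent

variable {E : Type*} [NormedAddCommGroup E] [InnerProductSpace ℝ E]

/-- First-order characterization of convexity. -/
theorem ConvexOn.add_inner_gradient_le [CompleteSpace E] {f : E → ℝ}
    (hconv : ConvexOn ℝ Set.univ f) {x : E} (hx : DifferentiableAt ℝ f x) (y : E) :
    f x + ⟪gradient f x, y - x⟫ ≤ f y := by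
  have hline : ConvexOn ℝ Set.univ (f ∘ AffineMap.lineMap (k := ℝ) x y) := by
    simpa using hconv.comp_affineMap (AffineMap.lineMap (k := ℝ) x y)
  have hderiv : HasDerivAt (f ∘ AffineMap.lineMap (k := ℝ) x y) (fderiv ℝ f x (y - x)) 0 := by
    refine HasFDerivAt.comp_hasDerivAt (0 : ℝ) ?_ AffineMap.hasDerivAt_lineMap
    simpa using hx.hasFDerivAt
  have hslope := hline.le_slope_of_hasDerivAt (Set.mem_univ 0) (Set.mem_univ 1) one_pos hderiv
  simp only [slope_def_field, Function.comp_apply, AffineMap.lineMap_apply_zero,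
    AffineMap.lineMap_apply_one, sub_zero, div_one] at hslope
  rw [inner_gradient_left]
  linarith

/-- A convex function with `L`-Lipschitz gradient increases at most quadratically
beyond its linearization. -/
theorem ConvexOn.le_add_inner_gradient_add_sq [CompleteSpace E] {f : E → ℝ}
    (hconv : ConvexOn ℝ Set.univ f) (hdiff : Differentiable ℝ f) {L : ℝ}
    (hLip : ∀ x y, ‖gradient f x - gradient f y‖ ≤ L * ‖x - y‖) (x y : E) :
    f y ≤ f x + ⟪gradient f x, y - x⟫ + L * ‖y - x‖ ^ 2 := by
  have hgrad := hconv.add_inner_gradient_le (hdiff y) x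
  have hdiff_inner : ⟪gradient f y - gradient f x, y - x⟫ ≤ L * ‖y - x‖ ^ 2 :=
    calc ⟪gradient f y - gradient f x, y - x⟫
        ≤ ‖gradient f y - gradient f x‖ * ‖y - x‖ := real_inner_le_norm _ _
      _ ≤ L * ‖y - x‖ * ‖y - x‖ := by gcongr; exact hLip y x
      _ = L * ‖y - x‖ ^ 2 := by ring
  rw [← neg_sub y x, inner_neg_right] at hgrad
  rw [inner_sub_left] at hdiff_inner
  linarith

theorem gradient_eq_zero_of_forall_le [CompleteSpace E] {f : E → ℝ} {v : E}
    (hv : ∀ y, f v ≤ f y) : gradient f v = 0 := by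
  have hmin : IsLocalMin f v := Eventually.of_forall hv
  simp [gradient, hmin.fderiv_eq_zero]

/-- Away from a nonempty bounded set of minimizers, a convex function exceeds its minimum
at least linearly in the distance to that set. -/
theorem ConvexOn.exists_mul_infDist_le_sub [FiniteDimensional ℝ E] {f : E → ℝ}
    (hconv : ConvexOn ℝ Set.univ f) (hcont : Continuous f)
    (hbd : Bornology.IsBounded {x | ∀ y, f x ≤ f y}) {v₀ : E} (hv₀ : ∀ y, f v₀ ≤ f y)
    {ε : ℝ} (hε : 0 < ε) :
    ∃ η > 0, ∀ x, ε ≤ Metric.infDist x {x | ∀ y, f x ≤ f y} →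
      η * Metric.infDist x {x | ∀ y, f x ≤ f y} ≤ f x - f v₀ := by
  have : ProperSpace E := FiniteDimensional.proper ℝ E
  set S : Set E := {x | ∀ y, f x ≤ f y} with hS
  have hne : S.Nonempty := ⟨v₀, hv₀⟩
  have hclosed : IsClosed S := by
    simp only [hS, Set.ofPred_forall]
    exact isClosed_iInter fun y => isClosed_le hcont continuous_const
  have hcompact : IsCompact {x | Metric.infDist x S = ε} := by
    refine (Metric.isCompact_of_isClosed_isBounded hclosed hbd).cthickening (r := ε)
      |>.of_isClosed_subset
        (isClosed_eq (Metric.continuous_infDist_pt S) continuous_const) fun x hx => ?_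
    obtain ⟨v, hvS, hv⟩ := hclosed.exists_infDist_eq_dist hne x
    exact Metric.mem_cthickening_of_dist_le x v ε S hvS (hv.symm.trans hx).le
  obtain ⟨δ, hδ, hδle⟩ : ∃ δ > 0, ∀ y, Metric.infDist y S = ε → δ ≤ f y - f v₀ := by
    rcases Set.eq_empty_or_nonempty {x | Metric.infDist x S = ε} with hempty | hnonempty
    · exact ⟨1, one_pos, fun y hy => (Set.eq_empty_iff_forall_notMem.mp hempty y hy).elim⟩
    · obtain ⟨z, hz, hzmin⟩ := hcompact.exists_isMinOn hnonempty hcont.continuousOn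
      refine ⟨f z - f v₀, ?_, fun y hy => sub_le_sub_right (hzmin hy) _⟩
      by_contra! hle
      have hzS : z ∈ S := fun y => (sub_nonpos.mp hle).trans (hv₀ y)
      have hzε : Metric.infDist z S = ε := hz
      rw [Metric.infDist_zero_of_mem hzS] at hzε
      exact hε.ne hzε
  refine ⟨δ / ε, div_pos hδ hε, fun x hx => ?_⟩
  obtain ⟨v, hvS, hv⟩ := hclosed.exists_infDist_eq_dist hne x
  set r := Metric.infDist x S with hr
  have hr0 : 0 < r := hε.trans_le hx
  have hs0 : 0 ≤ ε / r := by positivity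
  have hs1 : ε / r ≤ 1 := (div_le_one hr0).mpr hx
  set y := AffineMap.lineMap v x (ε / r) with hy
  have hyv : dist y v = ε := by
    rw [hy, dist_lineMap_left, dist_comm v x, ← hv, Real.norm_of_nonneg hs0,
      div_mul_cancel₀ _ hr0.ne']
  have hyx : dist x y = r - ε := by
    rw [hy, dist_comm, dist_lineMap_right, dist_comm v x, ← hv,
      Real.norm_of_nonneg (sub_nonneg.mpr hs1)]
    field_simp
  have hyε : Metric.infDist y S = ε := by
    refine le_antisymm ((Metric.infDist_le_dist_of_mem hvS).trans hyv.le) ?_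
    have := Metric.infDist_le_infDist_add_dist (s := S) (x := x) (y := y)
    linarith
  have hfy : f y ≤ (1 - ε / r) * f v + ε / r * f x := by
    rw [hy, AffineMap.lineMap_apply_module]
    exact hconv.2 (Set.mem_univ v) (Set.mem_univ x) (sub_nonneg.mpr hs1) hs0 (by ring)
  have hfv : f v = f v₀ := le_antisymm (hvS v₀) (hv₀ v)
  have hδx : δ ≤ ε / r * (f x - f v₀) := by
    have := hδle y hyε
    rw [hfv] at hfy
    linarith
  rw [div_mul_eq_mul_div, le_div_iff₀ hr0] at hδx
  rw [div_mul_eq_mul_div, div_le_iff₀ hε]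
  linarith

/-- A sequence bounded below whose steps eventually either decrease by `κ * γ t`, with
`∑ γ t = ∞`, or stay below the level `a`, is eventually below `a`. -/
theorem eventually_lt_of_decrease_or_lt {F γ : ℕ → ℝ} {a m κ : ℝ} (hκ : 0 < κ)
    (hγ : ∀ t, 0 ≤ γ t) (hsum : Tendsto (fun n => ∑ t ∈ Finset.range n, γ t) atTop atTop)
    (hm : ∀ t, m ≤ F t)
    (hstep : ∀ᶠ t in atTop, F (t + 1) ≤ F t - κ * γ t ∨ F t < a ∧ F (t + 1) < a) :
    ∀ᶠ t in atTop, F t < a := by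
  obtain ⟨T, hT⟩ := eventually_atTop.mp hstep
  obtain ⟨s, hTs, hs⟩ : ∃ s ≥ T, F s < a := by
    by_contra! hge
    have hbound : ∀ t ≥ T, F t + κ * ∑ i ∈ Finset.range t, γ i
        ≤ F T + κ * ∑ i ∈ Finset.range T, γ i := by
      intro t ht
      induction t, ht using Nat.le_induction with
      | base => exact le_rfl
      | succ t ht ih =>
        have hdec := (hT t ht).resolve_right fun h => (hge t ht).not_gt h.1
        rw [Finset.sum_range_succ]
        linarith
    obtain ⟨t, hlarge, ht⟩ := ((hsum.const_mul_atTop hκ).eventually_gt_atTop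
      (F T + κ * ∑ i ∈ Finset.range T, γ i - m) |>.and (eventually_ge_atTop T)).exists
    linarith [hbound t ht, hm t]
  refine eventually_atTop.mpr ⟨s, fun t ht => ?_⟩
  induction t, ht using Nat.le_induction with
  | base => exact hs
  | succ t ht ih =>
    rcases hT t (hTs.trans ht) with hdec | hlt
    · linarith [mul_nonneg hκ.le (hγ t)]
    · exact hlt.2

end GradientDescent

/-- Theorem 8 (diminishing step-sizes, quantized gradient method): if `D` is a
`θ`-cover, `γ(t) ≥ 0`, `γ(t) → 0` and `∑ γ(t) = ∞`, then the quantized gradient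
iterates converge to the set of minimizers of `f`. -/
theorem diminishing_step_quantized {N : ℕ} (hN : 1 ≤ N)
    (f : EuclideanSpace ℝ (Fin N) → ℝ)
    (hconv : ConvexOn ℝ Set.univ f) (hdiff : Differentiable ℝ f)
    (L : ℝ) (hL : 0 < L)
    (hLip : ∀ x y, ‖gradient f x - gradient f y‖ ≤ L * ‖x - y‖)
    (hXne : {x : EuclideanSpace ℝ (Fin N) | ∀ y, f x ≤ f y}.Nonempty)
    (hXbd : Bornology.IsBounded {x : EuclideanSpace ℝ (Fin N) | ∀ y, f x ≤ f y})
    (θ : ℝ) (hθ : θ ∈ Set.Ico 0 (π / 2))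
    (D : Finset (EuclideanSpace ℝ (Fin N))) (hD : ∀ d ∈ D, ‖d‖ = 1)
    (hcover : ∀ g : EuclideanSpace ℝ (Fin N), ‖g‖ = 1 → ∃ d ∈ D, Real.cos θ ≤ ⟪g, d⟫)
    (γ : ℕ → ℝ) (hγnonneg : ∀ t, 0 ≤ γ t)
    (hγ0 : Tendsto γ atTop (nhds 0))
    (hγsum : Tendsto (fun n => ∑ t ∈ Finset.range n, γ t) atTop atTop)
    -- the quantized gradient iterates
    (x d : ℕ → EuclideanSpace ℝ (Fin N))
    (hdD : ∀ t, d t ∈ D)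
    (hang : ∀ t, Real.cos θ * ‖gradient f (x t)‖ ≤ ⟪gradient f (x t), d t⟫)
    (hiter : ∀ t, x (t + 1) = x t - γ t • d t) :
    Tendsto (fun t => Metric.infDist (x t)
        {x : EuclideanSpace ℝ (Fin N) | ∀ y, f x ≤ f y}) atTop (nhds 0) := by
  obtain ⟨v₀, hv₀⟩ := hXne
  have hv₀ : ∀ y, f v₀ ≤ f y := hv₀
  have hcos : 0 < Real.cos θ :=
    Real.cos_pos_of_mem_Ioo ⟨by linarith [hθ.1, Real.pi_pos], hθ.2⟩
  set S : Set (EuclideanSpace ℝ (Fin N)) := {x | ∀ y, f x ≤ f y} with hS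
  have hclosed : IsClosed S := by
    simp only [hS, Set.ofPred_forall]
    exact isClosed_iInter fun y => isClosed_le hdiff.continuous continuous_const
  have hdescent : ∀ t, f (x (t + 1)) ≤
      f (x t) - γ t * (Real.cos θ * ‖gradient f (x t)‖) + L * γ t ^ 2 := by
    intro t
    have hquad := hconv.le_add_inner_gradient_add_sq hdiff hLip (x t) (x (t + 1))
    have hsub : x (t + 1) - x t = -(γ t • d t) := by rw [hiter]; abel
    rw [hsub, inner_neg_right, real_inner_smul_right, norm_neg, norm_smul, hD _ (hdD t),
      Real.norm_of_nonneg (hγnonneg t), mul_one] at hquad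
    linarith [mul_le_mul_of_nonneg_left (hang t) (hγnonneg t)]
  have hquadS : ∀ z, f z - f v₀ ≤ L * Metric.infDist z S ^ 2 := by
    intro z
    obtain ⟨v, hvS, hv⟩ := hclosed.exists_infDist_eq_dist ⟨v₀, hv₀⟩ z
    have hquad := hconv.le_add_inner_gradient_add_sq hdiff hLip v z
    rw [gradient_eq_zero_of_forall_le hvS, inner_zero_left, ← dist_eq_norm, ← hv] at hquad
    linarith [hvS v₀]
  have hgrad : ∀ z, f z - f v₀ ≤ ‖gradient f z‖ * Metric.infDist z S := by
    intro z
    obtain ⟨v, hvS, hv⟩ := hclosed.exists_infDist_eq_dist ⟨v₀, hv₀⟩ z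
    have hlin := hconv.add_inner_gradient_le (hdiff z) v
    have hcs := real_inner_le_norm (gradient f z) (z - v)
    rw [← dist_eq_norm, ← hv] at hcs
    rw [← neg_sub z v, inner_neg_right] at hlin
    linarith [hvS v₀]
  have hlevel : ∀ δ > 0, ∀ᶠ t in atTop, f (x t) < f v₀ + δ := by
    intro δ hδ
    obtain ⟨ε, hε, hεδ⟩ : ∃ ε > 0, L * ε ^ 2 ≤ δ / 2 := by
      refine ⟨√(δ / (2 * L)), by positivity, ?_⟩
      rw [Real.sq_sqrt (by positivity)]
      apply le_of_eq
      field_simp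
    obtain ⟨η, hη, hηle⟩ :=
      hconv.exists_mul_infDist_le_sub hdiff.continuous hXbd hv₀ hε
    have hγ_small : ∀ᶠ t in atTop, γ t < Real.cos θ * η / (2 * L) :=
      hγ0.eventually_lt_const (by positivity)
    have hγ_le : ∀ᶠ t in atTop, γ t < ε := hγ0.eventually_lt_const hε
    refine eventually_lt_of_decrease_or_lt (F := fun t => f (x t)) (m := f v₀)
      (κ := Real.cos θ * η / 2) (by positivity) hγnonneg hγsum (fun t => hv₀ _) ?_
    filter_upwards [hγ_small, hγ_le] with t hγ1 hγ2
    have hdesc := hdescent t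
    rcases le_or_gt ε (Metric.infDist (x t) S) with hfar | hnear
    · left
      have hηgrad : η ≤ ‖gradient f (x t)‖ :=
        le_of_mul_le_mul_right ((hηle _ hfar).trans (hgrad _)) (hε.trans_le hfar)
      have hmain : γ t * (Real.cos θ * η) ≤ γ t * (Real.cos θ * ‖gradient f (x t)‖) :=
        mul_le_mul_of_nonneg_left (mul_le_mul_of_nonneg_left hηgrad hcos.le) (hγnonneg t)
      rw [lt_div_iff₀ (by positivity)] at hγ1
      have herr := mul_le_mul_of_nonneg_left hγ1.le (hγnonneg t)
      linarith
    · right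
      have hnear_sq : L * Metric.infDist (x t) S ^ 2 < L * ε ^ 2 := by
        have := Metric.infDist_nonneg (x := x t) (s := S)
        gcongr
      have hγ_sq : L * γ t ^ 2 ≤ L * ε ^ 2 := by
        have := hγnonneg t
        gcongr
      have hdrop : 0 ≤ γ t * (Real.cos θ * ‖gradient f (x t)‖) :=
        mul_nonneg (hγnonneg t) (by positivity)
      constructor <;> linarith [hquadS (x t)]
  refine tendsto_order.mpr ⟨fun a ha => Eventually.of_forall fun t =>
    ha.trans_le Metric.infDist_nonneg, fun ε hε => ?_⟩
  obtain ⟨η, hη, hηle⟩ := hconv.exists_mul_infDist_le_sub hdiff.continuous hXbd hv₀ hε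
  filter_upwards [hlevel (η * ε) (by positivity)] with t ht
  by_contra! hfar
  linarith [hηle _ hfar, mul_le_mul_of_nonneg_left hfar hη.le]
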